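/- Let G be a digraph on n vertices with no self-loops that contains a reverse directed spanning tree, and fix weights a_{ij} > 0 for j ∈ N_i. Then there exists k1* > 0 such that for every gain k1 > k1*, the feedback u_i = ‖f_i(x)‖·(R(θ_i)⁻¹f_i(x))·e1, ω_i = −k1 (R(θ_i)⁻¹f_i(x))·e2 solves the rendezvous control problem for the closed-loop unicycle system: (stability) for every ε > 0 there is δ > 0 such that every solution with D(x(0)) < δ satisfies D(x(t)) < ε for all t in its interval of existence; and (completeness and global attractivity) every maximal solution is defined on all of [0,∞) and satisfies D(x(t)) → 0 as t → ∞. -/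

import Mathlib

open Matrix
open scoped BigOperators ENNReal

/-- The rotation matrix `R(θ)`. -/
noncomputable def rotM (θ : ℝ) : Matrix (Fin 2) (Fin 2) ℝ :=
  !![Real.cos θ, -Real.sin θ; Real.sin θ, Real.cos θ]

/-- Euclidean norm on ℝ². -/
noncomputable def enorm2 (v : Fin 2 → ℝ) : ℝ :=
  Real.sqrt (v 0 ^ 2 + v 1 ^ 2)

/-- The linear consensus vector field `f_i(x) = Σ_{j∈N_i} a_{ij}(x_j - x_i)`. -/
noncomputable def fcons {n : ℕ} (Adj : Fin n → Fin n → Bool) (a : Fin n → Fin n → ℝ)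
    (x : Fin n → Fin 2 → ℝ) (i : Fin n) : Fin 2 → ℝ :=
  ∑ j : Fin n, if Adj i j = true then a i j • (x j - x i) else 0

/-- The linear speed feedback `u_i = ‖f_i(x)‖ · (R(θᵢ)⁻¹ f_i(x)) · e1`. -/
noncomputable def uFB {n : ℕ} (Adj : Fin n → Fin n → Bool) (a : Fin n → Fin n → ℝ)
    (x : Fin n → Fin 2 → ℝ) (θi : ℝ) (i : Fin n) : ℝ :=
  enorm2 (fcons Adj a x i) * (((rotM θi)⁻¹ *ᵥ fcons Adj a x i) 0)

/-- The angular speed feedback `ω_i = -k1 (R(θᵢ)⁻¹ f_i(x)) · e2`. -/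
noncomputable def omegaFB {n : ℕ} (k1 : ℝ) (Adj : Fin n → Fin n → Bool)
    (a : Fin n → Fin n → ℝ) (x : Fin n → Fin 2 → ℝ) (θi : ℝ) (i : Fin n) : ℝ :=
  -k1 * (((rotM θi)⁻¹ *ᵥ fcons Adj a x i) 1)

/-- `(x, θ)` is a solution of the closed-loop unicycle system on `[0, T)`. -/
def IsSolOn {n : ℕ} (Adj : Fin n → Fin n → Bool) (a : Fin n → Fin n → ℝ) (k1 : ℝ)
    (x : ℝ → Fin n → Fin 2 → ℝ) (θ : ℝ → Fin n → ℝ) (T : ℝ≥0∞) : Prop :=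
  ∀ t : ℝ, 0 ≤ t → ENNReal.ofReal t < T → ∀ i : Fin n,
    HasDerivWithinAt (fun s => x s i)
      (uFB Adj a (x t) (θ t i) i • (rotM (θ t i) *ᵥ ![1, 0])) (Set.Ici 0) t ∧
    HasDerivWithinAt (fun s => θ s i) (omegaFB k1 Adj a (x t) (θ t i) i) (Set.Ici 0) t

/-- A maximal solution: a solution on `[0, T)` admitting no proper extension. -/
def IsMaxSol {n : ℕ} (Adj : Fin n → Fin n → Bool) (a : Fin n → Fin n → ℝ) (k1 : ℝ)
    (x : ℝ → Fin n → Fin 2 → ℝ) (θ : ℝ → Fin n → ℝ) (T : ℝ≥0∞) : Prop :=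
  IsSolOn Adj a k1 x θ T ∧
    ∀ (x' : ℝ → Fin n → Fin 2 → ℝ) (θ' : ℝ → Fin n → ℝ) (T' : ℝ≥0∞),
      T < T' → IsSolOn Adj a k1 x' θ' T' →
        ¬(∀ t : ℝ, 0 ≤ t → ENNReal.ofReal t < T → x' t = x t ∧ θ' t = θ t)

/-- `D(x) = max_{i,j} ‖x_i - x_j‖`. -/
noncomputable def Dmax {n : ℕ} (x : Fin n → Fin 2 → ℝ) : ℝ :=
  ⨆ i : Fin n, ⨆ j : Fin n, enorm2 (x i - x j)

section Rendezvous

open Set Filter Topology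
open scoped NNReal

/-- First-contact comparison principle for a finite family. -/
theorem family_neg_of_deriv_neg {ι : Type*} [Finite ι] {s S : ℝ} {φ φ' : ι → ℝ → ℝ}
    (hd : ∀ k, ∀ t ∈ Icc s S, HasDerivWithinAt (φ k) (φ' k t) (Icc s S) t)
    (h0 : ∀ k, φ k s < 0)
    (hneg : ∀ t ∈ Icc s S, ∀ k, φ k t = 0 → (∀ l, φ l t ≤ 0) → φ' k t < 0) :
    ∀ t ∈ Icc s S, ∀ k, φ k t < 0 := by
  have hc : ∀ k, ContinuousOn (φ k) (Icc s S) := fun k t ht => (hd k t ht).continuousWithinAt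
  by_contra! hex
  obtain ⟨t₁, ht₁, k₁, hk₁⟩ := hex
  set K : Set ℝ := ⋃ k, Icc s S ∩ φ k ⁻¹' Ici 0 with hK
  have hKc : IsClosed K :=
    isClosed_iUnion_of_finite fun k => (hc k).preimage_isClosed_of_isClosed isClosed_Icc isClosed_Ici
  have hKne : K.Nonempty := ⟨t₁, mem_iUnion.2 ⟨k₁, ht₁, hk₁⟩⟩
  have hKb : BddBelow K := ⟨s, fun t ht => by
    obtain ⟨k, hk, -⟩ := mem_iUnion.1 ht
    exact hk.1⟩
  set τ := sInf K
  obtain ⟨k, hτ, hkτ⟩ := mem_iUnion.1 (hKc.csInf_mem hKne hKb)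
  have hbefore : ∀ t ∈ Ico s τ, ∀ l, φ l t < 0 := by
    intro t ht l
    by_contra! h
    exact absurd (csInf_le hKb (mem_iUnion.2 ⟨l, ⟨ht.1, ht.2.le.trans hτ.2⟩, h⟩)) (not_le.2 ht.2)
  have hsτ : s < τ := by
    rcases hτ.1.eq_or_lt with h | h
    · exact absurd hkτ (by simpa [← h] using h0 k)
    · exact h
  have hsub : Ico s τ ⊆ Icc s S := fun t ht => ⟨ht.1, ht.2.le.trans hτ.2⟩
  have hne : (𝓝[Ico s τ] τ).NeBot := by
    rw [← mem_closure_iff_nhdsWithin_neBot, closure_Ico hsτ.ne]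
    exact right_mem_Icc.2 hsτ.le
  have hle : ∀ l, φ l τ ≤ 0 := fun l =>
    le_of_tendsto ((hc l τ hτ).mono hsub) (eventually_mem_nhdsWithin.mono fun t ht => (hbefore t ht l).le)
  have heq : φ k τ = 0 := le_antisymm (hle k) hkτ
  have hslope := (hasDerivWithinAt_iff_tendsto_slope' (by simp)).1 ((hd k τ hτ).mono hsub)
  refine absurd (ge_of_tendsto hslope (b := 0) (eventually_mem_nhdsWithin.mono fun t ht => ?_))
    (not_le.2 (hneg τ hτ k heq hle))
  rw [slope_def_field, heq, sub_zero]
  exact div_nonneg_of_nonpos (hbefore t ht k).le (sub_nonpos.2 ht.2.le)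

/-- Differential inequalities satisfied by the deficits `v i` of a perturbed consensus system. -/
structure DeficitSystem {ι : Type*} [Fintype ι] (b : ι → ι → ℝ) (G ε w : ℝ)
    (v v' g h : ι → ℝ → ℝ) : Prop where
  deriv : ∀ i, ∀ t ∈ Icc 0 w, HasDerivWithinAt (v i) (v' i t) (Icc 0 w) t
  rate : ∀ i, ∀ t ∈ Icc 0 w, -(g i t * h i t) - ε ≤ v' i t
  abs_le : ∀ i, ∀ t ∈ Icc 0 w, |h i t| ≤ g i t
  gain_le : ∀ i, ∀ t ∈ Icc 0 w, g i t ≤ G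
  drift_le : ∀ i, ∀ t ∈ Icc 0 w, h i t ≤ ∑ j, b i j * (v i t - v j t) + ε
  init : ∀ i, 0 ≤ v i 0

namespace DeficitSystem

variable {ι : Type*} [Fintype ι] {b : ι → ι → ℝ} {G ε w : ℝ} {v v' g h : ι → ℝ → ℝ}

theorem neg_lt (hs : DeficitSystem b G ε w v v' g h) (hb : ∀ i j, 0 ≤ b i j) (hG : 0 ≤ G)
    (hε : 0 < ε) (hw : w ≤ 1) : ∀ t ∈ Icc 0 w, ∀ i, -((G + 3) * ε) < v i t := by
  have key := family_neg_of_deriv_neg (s := 0) (S := w)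
    (φ := fun i t => -v i t - ε - (G + 2) * ε * t) (φ' := fun i t => -v' i t - (G + 2) * ε)
    (fun i t ht => by
      have := (((hs.deriv i t ht).neg.sub_const ε).sub
        ((hasDerivWithinAt_id t (Icc 0 w)).const_mul ((G + 2) * ε)))
      exact this.congr_deriv (by simp))
    (fun i => by have := hs.init i; simp only [mul_zero]; linarith)
    (fun t ht i hi hl => by
      have hmin : ∀ j, v i t ≤ v j t := fun j => by have := hl j; linarith
      have hsum : ∑ j, b i j * (v i t - v j t) ≤ 0 :=
        Finset.sum_nonpos fun j _ => mul_nonpos_of_nonneg_of_nonpos (hb i j) (by linarith [hmin j])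
      have h1 := hs.drift_le i t ht
      have h2 := hs.rate i t ht
      have h3 := hs.gain_le i t ht
      have h4 := (abs_nonneg _).trans (hs.abs_le i t ht)
      have h5 : g i t * h i t ≤ G * ε :=
        (mul_le_mul_of_nonneg_left (by linarith : h i t ≤ ε) h4).trans
          (mul_le_mul_of_nonneg_right h3 hε.le)
      nlinarith)
  intro t ht i
  have := key t ht i
  have h1 : (G + 2) * ε * t ≤ (G + 2) * ε * 1 :=
    mul_le_mul_of_nonneg_left (ht.2.trans hw) (by positivity)
  linarith

theorem root_lower (hs : DeficitSystem b G ε w v v' g h) (hε : ε ≤ 1)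
    (hw : w * (8 * (G ^ 2 + 2)) ≤ 1) {r : ι} (hr : 1 / 2 ≤ v r 0) :
    ∀ t ∈ Icc 0 w, 1 / 8 ≤ v r t := by
  have key := family_neg_of_deriv_neg (ι := Unit) (s := 0) (S := w)
    (φ := fun _ t => 1 / 4 - (G ^ 2 + 2) * t - v r t) (φ' := fun _ t => -(G ^ 2 + 2) - v' r t)
    (fun _ t ht => by
      have := (((hasDerivWithinAt_id t (Icc 0 w)).const_mul (G ^ 2 + 2)).const_sub (1 / 4)).sub
        (hs.deriv r t ht)
      exact this.congr_deriv (by simp))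
    (fun _ => by simp only [mul_zero]; linarith)
    (fun t ht _ _ _ => by
      have h2 := hs.rate r t ht
      have h3 := hs.gain_le r t ht
      have h4 := hs.abs_le r t ht
      have h5 := (abs_nonneg _).trans h4
      have h6 : g r t * h r t ≤ G ^ 2 :=
        (mul_le_mul_of_nonneg_left ((le_abs_self _).trans h4) h5).trans (by nlinarith)
      linarith)
  intro t ht
  have := key t ht ()
  have : (G ^ 2 + 2) * t ≤ (G ^ 2 + 2) * w := mul_le_mul_of_nonneg_left ht.2 (by positivity)
  linarith

theorem step_lower (hs : DeficitSystem b G ε w v v' g h) (hb : ∀ i j, 0 ≤ b i j) (hG : 0 ≤ G)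
    (hε : 0 < ε) (hw : w ≤ 1) {A : ℝ} (hA : ∀ i, ∑ j, b i j ≤ A) (hA0 : 0 ≤ A)
    {i j : ι} {s β κ : ℝ} (hs0 : 0 ≤ s) (hβ : 0 < β) (hκ : 0 < κ)
    (hj : ∀ t ∈ Icc s w, β ≤ v j t) (hbij : 0 < b i j)
    (h1 : A * κ ≤ b i j * β / 4) (h2 : A * ((G + 3) * ε) + ε ≤ b i j * β / 4)
    (h3 : κ + ε < (b i j * β / 2) ^ 2) :
    ∀ t ∈ Icc s w, κ * (t - s) - 2 * ((G + 3) * ε) ≤ v i t := by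
  have hlow := hs.neg_lt hb hG hε hw
  set δ := (G + 3) * ε with hδ
  have hδ0 : 0 < δ := by positivity
  rcases lt_or_ge w s with hws | hsw
  · intro t ht
    exact absurd (ht.1.trans ht.2) (not_le.2 hws)
  have hsub : Icc s w ⊆ Icc 0 w := Icc_subset_Icc_left hs0
  have key := family_neg_of_deriv_neg (ι := Unit) (s := s) (S := w)
    (φ := fun _ t => κ * (t - s) - 2 * δ - v i t) (φ' := fun _ t => κ - v' i t)
    (fun _ t ht => by
      have := ((((hasDerivWithinAt_id t (Icc s w)).sub_const s).const_mul κ).sub_const (2 * δ)).sub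
        ((hs.deriv i t (hsub ht)).mono hsub)
      exact this.congr_deriv (by simp))
    (fun _ => by
      have := hlow s ⟨hs0, hsw⟩ i
      simp only [sub_self, mul_zero]
      linarith)
    (fun t ht _ hz _ => by
      have ht' := hsub ht
      have hvi : v i t + δ ≤ κ + δ := by
        have : κ * (t - s) ≤ κ * 1 :=
          mul_le_mul_of_nonneg_left (by linarith [ht.2]) hκ.le
        linarith
      have hsum : ∑ l, b i l * (v i t - v l t) ≤ A * (κ + δ) - b i j * (v j t + δ) := by
        have e : ∑ l, b i l * (v i t - v l t)
            = (∑ l, b i l) * (v i t + δ) - ∑ l, b i l * (v l t + δ) := by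
          rw [Finset.sum_mul, ← Finset.sum_sub_distrib]
          exact Finset.sum_congr rfl fun l _ => by ring
        have hpos : ∀ l, 0 ≤ v l t + δ := fun l => by linarith [hlow t ht' l]
        have e1 : b i j * (v j t + δ) ≤ ∑ l, b i l * (v l t + δ) :=
          Finset.single_le_sum (f := fun l => b i l * (v l t + δ))
            (fun l _ => mul_nonneg (hb i l) (hpos l)) (Finset.mem_univ j)
        have e2 : (∑ l, b i l) * (v i t + δ) ≤ A * (κ + δ) :=
          mul_le_mul (hA i) hvi (hpos i) hA0
        linarith
      have hvj : b i j * β ≤ b i j * (v j t + δ) :=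
        mul_le_mul_of_nonneg_left (by linarith [hj t ht]) hbij.le
      have hh : h i t ≤ -(b i j * β / 2) := by
        have := hs.drift_le i t ht'
        nlinarith
      have hg : b i j * β / 2 ≤ g i t := by
        have := hs.abs_le i t ht'
        linarith [neg_abs_le (h i t)]
      have hp : 0 < b i j * β / 2 := by positivity
      have hgh : (b i j * β / 2) ^ 2 ≤ -(g i t * h i t) := by nlinarith
      linarith [hs.rate i t ht'])
  intro t ht
  have := key t ht ()
  linarith

end DeficitSystem

/-- Along a path to `r`, a deficit at `r` propagates to a uniform deficit at the final time. -/
theorem exists_deficit_lower_of_path {ι : Type*} [Fintype ι] {b : ι → ι → ℝ}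
    (hb : ∀ i j, 0 ≤ b i j) {A G w : ℝ} (hA : ∀ i, ∑ j, b i j ≤ A) (hA0 : 0 ≤ A) (hG : 0 ≤ G)
    (hw0 : 0 < w) (hw1 : w ≤ 1) (hw : w * (8 * (G ^ 2 + 2)) ≤ 1) {i r : ι}
    (hpath : Relation.ReflTransGen (fun p q => 0 < b p q) i r) :
    ∃ β > 0, ∃ ε₀ > 0, ∃ s, 0 ≤ s ∧ s < w ∧ ∀ ε, 0 < ε → ε ≤ ε₀ → ∀ v v' g h,
      DeficitSystem b G ε w v v' g h → 1 / 2 ≤ v r 0 → ∀ t ∈ Icc s w, β ≤ v i t := by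
  induction hpath using Relation.ReflTransGen.head_induction_on with
  | refl =>
    exact ⟨1 / 8, by norm_num, 1, one_pos, 0, le_rfl, hw0, fun ε _ hε v v' g h hs hr =>
      hs.root_lower hε hw hr⟩
  | @head i j hij _ ih =>
    obtain ⟨β, hβ, ε₁, hε₁, s, hs0, hsw, hj⟩ := ih
    set c := b i j * β with hc
    have hc0 : 0 < c := mul_pos hij hβ
    obtain ⟨κ, hκ, hκ1, hκ2⟩ : ∃ κ > 0, A * κ ≤ c / 4 ∧ κ ≤ c ^ 2 / 16 := by
      refine ⟨min (c / (4 * (A + 1))) (c ^ 2 / 16), by positivity, ?_, min_le_right _ _⟩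
      have : A * (c / (4 * (A + 1))) ≤ c / 4 := by
        rw [mul_div_assoc', div_le_div_iff₀ (by positivity) (by positivity)]
        nlinarith
      exact (mul_le_mul_of_nonneg_left (min_le_left _ _) hA0).trans this
    have hsw' : 0 < w - s := sub_pos.2 hsw
    set ε₂ := c / (4 * (A * (G + 3) + 1))
    set ε₄ := κ * (w - s) / (8 * (G + 3))
    refine ⟨κ * (w - s) / 4, by positivity, min (min ε₁ ε₂) (min (c ^ 2 / 16) ε₄), by positivity,
      (s + w) / 2, by linarith, by linarith, fun ε hε hle v v' g h hs hr t ht => ?_⟩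
    have l1 : ε ≤ ε₁ := hle.trans ((min_le_left _ _).trans (min_le_left _ _))
    have l2 : ε ≤ ε₂ := hle.trans ((min_le_left _ _).trans (min_le_right _ _))
    have l3 : ε ≤ c ^ 2 / 16 := hle.trans ((min_le_right _ _).trans (min_le_left _ _))
    have l4 : ε ≤ ε₄ := hle.trans ((min_le_right _ _).trans (min_le_right _ _))
    rw [le_div_iff₀ (by positivity)] at l2 l4
    have hstep := hs.step_lower hb hG hε hw1 hA hA0 hs0 hβ hκ
      (hj ε hε l1 v v' g h hs hr) hij hκ1 (by linarith)
      (by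
        have : 0 < c ^ 2 := by positivity
        have e : (c / 2) ^ 2 = c ^ 2 / 4 := by ring
        rw [← hc, e]
        linarith) t ⟨by linarith [ht.1], ht.2⟩
    have : κ * ((w - s) / 2) ≤ κ * (t - s) :=
      mul_le_mul_of_nonneg_left (by linarith [ht.1]) hκ.le
    linarith

theorem exists_deficit_lower {ι : Type*} [Fintype ι] {b : ι → ι → ℝ}
    (hb : ∀ i j, 0 ≤ b i j) {A G w : ℝ} (hA : ∀ i, ∑ j, b i j ≤ A) (hA0 : 0 ≤ A) (hG : 0 ≤ G)
    (hw0 : 0 < w) (hw1 : w ≤ 1) (hw : w * (8 * (G ^ 2 + 2)) ≤ 1) {r : ι}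
    (hpath : ∀ i, Relation.ReflTransGen (fun p q => 0 < b p q) i r) :
    ∃ β > 0, ∃ ε₀ > 0, ∀ ε, 0 < ε → ε ≤ ε₀ → ∀ v v' g h,
      DeficitSystem b G ε w v v' g h → 1 / 2 ≤ v r 0 → ∀ i, β ≤ v i w := by
  choose β hβ ε₀ hε₀ s _ hs hlow using
    fun i => exists_deficit_lower_of_path hb hA hA0 hG hw0 hw1 hw (hpath i)
  have : Nonempty ι := ⟨r⟩
  obtain ⟨i₁, h₁⟩ := Finite.exists_min β
  obtain ⟨i₂, h₂⟩ := Finite.exists_min ε₀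
  exact ⟨β i₁, hβ i₁, ε₀ i₂, hε₀ i₂, fun ε hε hle v v' g h hsys hr i =>
    (h₁ i).trans (hlow i ε hε (hle.trans (h₂ i)) v v' g h hsys hr w ⟨(hs i).le, le_rfl⟩)⟩
/-- A locally Lipschitz field has a local forward solution through each point. -/
theorem LocallyLipschitz.exists_forward_solution {E : Type*} [NormedAddCommGroup E]
    [NormedSpace ℝ E] [CompleteSpace E] {V : E → E} (hV : LocallyLipschitz V) (T : ℝ) (y : E) :
    ∃ δ > 0, ∃ α : ℝ → E, α T = y ∧
      ∀ t ∈ Icc T (T + δ), HasDerivWithinAt α (V (α t)) (Icc T (T + δ)) t := by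
  obtain ⟨K, U, hU, hKU⟩ := hV y
  obtain ⟨ρ, hρ, hρU⟩ := Metric.nhds_basis_closedBall.mem_iff.1 hU
  lift ρ to ℝ≥0 using hρ.le
  set L : ℝ≥0 := ‖V y‖₊ + K * ρ
  have hL : ∀ z ∈ Metric.closedBall y ρ, ‖V z‖ ≤ L := fun z hz => by
    have h1 := hKU.dist_le_mul z (hρU hz) y (hρU (Metric.mem_closedBall_self ρ.2))
    have h2 : (K : ℝ) * dist z y ≤ K * ρ := mul_le_mul_of_nonneg_left hz K.2
    have h3 : ‖V z‖ ≤ ‖V y‖ + dist (V z) (V y) := by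
      rw [dist_eq_norm]
      exact norm_le_norm_add_norm_sub' _ _
    simp only [L, NNReal.coe_add, coe_nnnorm, NNReal.coe_mul]
    linarith
  have hδ : 0 < (ρ : ℝ) / (L + 1) := by positivity
  refine ⟨ρ / (L + 1), hδ, ?_⟩
  refine (IsPicardLindelof.of_time_independent (t₀ := ⟨T, le_rfl, by linarith⟩) (r := 0) hL
    (hKU.mono hρU) ?_).exists_eq_forall_mem_Icc_hasDerivWithinAt₀
  simp only [add_sub_cancel_left, sub_self, NNReal.coe_zero, sub_zero, max_eq_left hδ.le]
  rw [mul_div_assoc', div_le_iff₀ (by positivity)]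
  nlinarith [ρ.2]

/-- A solution on `[0, T)` along which the field is bounded extends beyond `T`. -/
theorem LocallyLipschitz.exists_extension {E : Type*} [NormedAddCommGroup E]
    [NormedSpace ℝ E] [CompleteSpace E] {V : E → E} (hV : LocallyLipschitz V) {T C : ℝ}
    (hT : 0 < T) {Y : ℝ → E}
    (hY : ∀ t ∈ Ico 0 T, HasDerivWithinAt Y (V (Y t)) (Ici 0) t)
    (hC : ∀ t ∈ Ico 0 T, ‖V (Y t)‖ ≤ C) :
    ∃ T' > T, ∃ Z : ℝ → E, (∀ t ∈ Ico 0 T', HasDerivWithinAt Z (V (Z t)) (Ici 0) t) ∧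
      ∀ t ∈ Ico 0 T, Z t = Y t := by
  have hC0 : 0 ≤ C := (norm_nonneg _).trans (hC 0 ⟨le_rfl, hT⟩)
  lift C to ℝ≥0 using hC0
  have hlip : LipschitzOnWith C Y (Ico 0 T) :=
    (convex_Ico 0 T).lipschitzOnWith_of_nnnorm_hasDerivWithin_le
      (fun t ht => (hY t ht).mono Ico_subset_Ici_self) hC
  have hIco : Ico 0 T ∈ 𝓝[<] T := Ico_mem_nhdsLT hT
  obtain ⟨y, hy⟩ : ∃ y, Tendsto Y (𝓝[<] T) (𝓝 y) :=
    CompleteSpace.complete ((cauchy_nhds.mono nhdsWithin_le_nhds).map_of_le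
      hlip.uniformContinuousOn (le_principal_iff.2 hIco))
  obtain ⟨δ, hδ, α, hα0, hα⟩ := hV.exists_forward_solution T y
  classical
  set Z : ℝ → E := fun t => if t < T then Y t else α t with hZ
  have hZY : ∀ t < T, Z t = Y t := fun t ht => if_pos ht
  have hZα : ∀ t, T ≤ t → Z t = α t := fun t ht => if_neg (not_lt.2 ht)
  have hleft : ∀ t ∈ Ico 0 T, HasDerivWithinAt Z (V (Z t)) (Ici 0) t := fun t ht => by
    rw [hZY t ht.2]
    refine (hY t ht).congr_of_eventuallyEq ?_ (hZY t ht.2)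
    exact mem_nhdsWithin_of_mem_nhds (mem_of_superset (Iio_mem_nhds ht.2) hZY)
  have hright : ∀ t ∈ Ico T (T + δ), HasDerivWithinAt Z (V (Z t)) (Ici T) t := fun t ht => by
    rw [hZα t ht.1]
    refine (((hα t ⟨ht.1, ht.2.le⟩).congr (fun s hs => hZα s hs.1) (hZα t ht.1))).mono_of_mem_nhdsWithin ?_
    rw [← Ici_inter_Iic]
    exact inter_mem_nhdsWithin _ (Iic_mem_nhds ht.2)
  have hZT : Z T = y := (hZα T le_rfl).trans hα0
  have hZlim : Tendsto Z (𝓝[<] T) (𝓝 y) :=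
    hy.congr' (eventually_mem_nhdsWithin.mono fun t ht => (hZY t ht).symm)
  have hderiv : ∀ t ∈ Ioo 0 T, HasDerivAt Z (V (Z t)) t := fun t ht =>
    (hleft t ⟨ht.1.le, ht.2⟩).hasDerivAt (Ici_mem_nhds ht.1)
  have hT' : HasDerivWithinAt Z (V (Z T)) (Iic T) T := by
    refine hasDerivWithinAt_Iic_of_tendsto_deriv (s := Ioo 0 T)
      (fun t ht => (hderiv t ht).differentiableAt.differentiableWithinAt) ?_
      (Ioo_mem_nhdsLT hT) ?_
    · rw [ContinuousWithinAt, hZT]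
      exact hZlim.mono_left (nhdsWithin_mono _ Ioo_subset_Iio_self)
    · rw [hZT]
      refine ((hV.continuous.tendsto y).comp hZlim).congr' ?_
      filter_upwards [Ioo_mem_nhdsLT hT] with t ht using (hderiv t ht).deriv.symm
  refine ⟨T + δ, by linarith, Z, fun t ht => ?_, fun t ht => hZY t ht.2⟩
  rcases lt_trichotomy t T with h | rfl | h
  · exact hleft t ⟨ht.1, h⟩
  · exact (hT'.union (hright t ⟨le_rfl, ht.2⟩)).mono fun s _ => le_total s t
  · exact ((hright t ⟨h.le, ht.2⟩).hasDerivAt (Ici_mem_nhds h)).hasDerivWithinAt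

/-- The weight matrix of the digraph, extended by zero off the edges. -/
noncomputable def edgeWeight {n : ℕ} (Adj : Fin n → Fin n → Bool) (a : Fin n → Fin n → ℝ)
    (i j : Fin n) : ℝ :=
  if Adj i j = true then a i j else 0

/-- The consensus field of a weight matrix. -/
noncomputable def consField {n : ℕ} (b : Fin n → Fin n → ℝ) (x : Fin n → Fin 2 → ℝ) (i : Fin n) :
    Fin 2 → ℝ :=
  fun c => ∑ j, b i j * (x j c - x i c)

/-- The unit heading vector. -/
noncomputable def heading (θ : ℝ) : Fin 2 → ℝ := ![Real.cos θ, Real.sin θ]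

/-- The heading vector turned by a right angle. -/
noncomputable def normalDir (θ : ℝ) : Fin 2 → ℝ := ![-Real.sin θ, Real.cos θ]

/-- The component along the heading. -/
noncomputable def along (θ : ℝ) (v : Fin 2 → ℝ) : ℝ := Real.cos θ * v 0 + Real.sin θ * v 1

/-- The component across the heading. -/
noncomputable def across (θ : ℝ) (v : Fin 2 → ℝ) : ℝ := Real.cos θ * v 1 - Real.sin θ * v 0

/-- The closed-loop velocity of unicycle `i`. -/
noncomputable def velocity {n : ℕ} (b : Fin n → Fin n → ℝ) (x : Fin n → Fin 2 → ℝ)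
    (θ : Fin n → ℝ) (i : Fin n) : Fin 2 → ℝ :=
  fun c => enorm2 (consField b x i) * along (θ i) (consField b x i) * heading (θ i) c

/-- `d` bounds all coordinate differences of the configuration `x`. -/
def Spread {n : ℕ} (x : Fin n → Fin 2 → ℝ) (d : ℝ) : Prop :=
  ∀ i j c, x i c - x j c ≤ d

theorem Spread.mono {n : ℕ} {x : Fin n → Fin 2 → ℝ} {d d' : ℝ} (h : Spread x d) (hd : d ≤ d') :
    Spread x d' := fun i j c => (h i j c).trans hd

theorem Spread.div {n : ℕ} {x : Fin n → Fin 2 → ℝ} {d e : ℝ} (h : Spread x d) (he : 0 < e) :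
    Spread (fun i c => x i c / e) (d / e) := fun i j c => by
  rw [← sub_div]
  exact div_le_div_of_nonneg_right (h i j c) he.le

theorem rotM_inv (θ : ℝ) :
    (rotM θ)⁻¹ = !![Real.cos θ, Real.sin θ; -Real.sin θ, Real.cos θ] := by
  refine Matrix.inv_eq_right_inv ?_
  have := Real.sin_sq_add_cos_sq θ
  ext i j
  fin_cases i <;> fin_cases j <;> simp [rotM, Matrix.mul_apply, Fin.sum_univ_two] <;> linarith

theorem rotM_inv_mulVec_zero (θ : ℝ) (v : Fin 2 → ℝ) : ((rotM θ)⁻¹ *ᵥ v) 0 = along θ v := by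
  simp [rotM_inv, along, Matrix.mulVec, dotProduct, Fin.sum_univ_two]

theorem rotM_inv_mulVec_one (θ : ℝ) (v : Fin 2 → ℝ) : ((rotM θ)⁻¹ *ᵥ v) 1 = across θ v := by
  simp [rotM_inv, across, Matrix.mulVec, dotProduct, Fin.sum_univ_two]
  ring

theorem rotM_mulVec_e1 (θ : ℝ) : rotM θ *ᵥ ![1, 0] = heading θ := by
  ext c
  fin_cases c <;> simp [rotM, heading, Matrix.mulVec, dotProduct, Fin.sum_univ_two]

theorem fcons_eq_consField {n : ℕ} (Adj : Fin n → Fin n → Bool) (a : Fin n → Fin n → ℝ)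
    (x : Fin n → Fin 2 → ℝ) (i : Fin n) : fcons Adj a x i = consField (edgeWeight Adj a) x i := by
  ext c
  simp only [fcons, consField, edgeWeight, Finset.sum_apply]
  refine Finset.sum_congr rfl fun j _ => ?_
  split_ifs <;> simp

theorem velocity_eq {n : ℕ} (Adj : Fin n → Fin n → Bool) (a : Fin n → Fin n → ℝ)
    (x : Fin n → Fin 2 → ℝ) (θ : Fin n → ℝ) (i : Fin n) :
    uFB Adj a x (θ i) i • (rotM (θ i) *ᵥ ![1, 0]) = velocity (edgeWeight Adj a) x θ i := by
  rw [uFB, rotM_inv_mulVec_zero, rotM_mulVec_e1, fcons_eq_consField]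
  rfl

theorem omegaFB_eq {n : ℕ} (k1 : ℝ) (Adj : Fin n → Fin n → Bool) (a : Fin n → Fin n → ℝ)
    (x : Fin n → Fin 2 → ℝ) (θi : ℝ) (i : Fin n) :
    omegaFB k1 Adj a x θi i = -k1 * across θi (consField (edgeWeight Adj a) x i) := by
  rw [omegaFB, rotM_inv_mulVec_one, fcons_eq_consField]

theorem enorm2_nonneg (v : Fin 2 → ℝ) : 0 ≤ enorm2 v := Real.sqrt_nonneg _

theorem enorm2_sq (v : Fin 2 → ℝ) : enorm2 v ^ 2 = v 0 ^ 2 + v 1 ^ 2 :=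
  Real.sq_sqrt (by positivity)

theorem abs_apply_le_enorm2 (v : Fin 2 → ℝ) (c : Fin 2) : |v c| ≤ enorm2 v := by
  refine abs_le_of_sq_le_sq ?_ (enorm2_nonneg v)
  rw [enorm2_sq]
  fin_cases c <;> simp <;> positivity

theorem enorm2_le_add (v : Fin 2 → ℝ) : enorm2 v ≤ |v 0| + |v 1| := by
  refine Real.sqrt_le_iff.2 ⟨by positivity, ?_⟩
  nlinarith [sq_abs (v 0), sq_abs (v 1), mul_nonneg (abs_nonneg (v 0)) (abs_nonneg (v 1))]

theorem along_sq_add_across_sq (θ : ℝ) (v : Fin 2 → ℝ) :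
    along θ v ^ 2 + across θ v ^ 2 = enorm2 v ^ 2 := by
  rw [enorm2_sq, along, across]
  linear_combination (v 0 ^ 2 + v 1 ^ 2) * Real.sin_sq_add_cos_sq θ

theorem abs_along_le (θ : ℝ) (v : Fin 2 → ℝ) : |along θ v| ≤ enorm2 v :=
  abs_le_of_sq_le_sq (by nlinarith [along_sq_add_across_sq θ v]) (enorm2_nonneg v)

theorem abs_across_le (θ : ℝ) (v : Fin 2 → ℝ) : |across θ v| ≤ enorm2 v :=
  abs_le_of_sq_le_sq (by nlinarith [along_sq_add_across_sq θ v]) (enorm2_nonneg v)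

theorem along_mul_heading (θ : ℝ) (v : Fin 2 → ℝ) (c : Fin 2) :
    along θ v * heading θ c = v c - across θ v * normalDir θ c := by
  have := Real.sin_sq_add_cos_sq θ
  fin_cases c
  · simp [along, across, heading, normalDir]
    linear_combination v 0 * this
  · simp [along, across, heading, normalDir]
    linear_combination v 1 * this

theorem abs_heading_le (θ : ℝ) (c : Fin 2) : |heading θ c| ≤ 1 := by
  fin_cases c
  · simpa [heading] using Real.abs_cos_le_one θ
  · simpa [heading] using Real.abs_sin_le_one θ

theorem abs_normalDir_le (θ : ℝ) (c : Fin 2) : |normalDir θ c| ≤ 1 := by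
  fin_cases c
  · simpa [normalDir] using Real.abs_sin_le_one θ
  · simpa [normalDir] using Real.abs_cos_le_one θ

theorem enorm2_div (v : Fin 2 → ℝ) {e : ℝ} (he : 0 < e) :
    enorm2 (fun c => v c / e) = enorm2 v / e := by
  rw [enorm2, enorm2, div_pow, div_pow, ← add_div, Real.sqrt_div' _ (by positivity),
    Real.sqrt_sq he.le]

theorem along_div (θ : ℝ) (v : Fin 2 → ℝ) (e : ℝ) :
    along θ (fun c => v c / e) = along θ v / e := by
  simp only [along]; ring

theorem across_div (θ : ℝ) (v : Fin 2 → ℝ) (e : ℝ) :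
    across θ (fun c => v c / e) = across θ v / e := by
  simp only [across]; ring

theorem consField_div {n : ℕ} (b : Fin n → Fin n → ℝ) (x : Fin n → Fin 2 → ℝ) (i : Fin n) (e : ℝ) :
    consField b (fun i c => x i c / e) i = fun c => consField b x i c / e := by
  ext c
  simp only [consField, Finset.sum_div]
  exact Finset.sum_congr rfl fun j _ => by ring

theorem velocity_div {n : ℕ} (b : Fin n → Fin n → ℝ) (x : Fin n → Fin 2 → ℝ) (θ : Fin n → ℝ)
    (i : Fin n) (c : Fin 2) {e : ℝ} (he : 0 < e) :
    velocity b (fun i c => x i c / e) θ i c = velocity b x θ i c / e / e := by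
  simp only [velocity, consField_div, enorm2_div _ he, along_div]
  ring

section Bounds

variable {n : ℕ} {b : Fin n → Fin n → ℝ} {A : ℝ}

theorem abs_consField_le (hb : ∀ i j, 0 ≤ b i j) (hA : ∀ i, ∑ j, b i j ≤ A)
    {x : Fin n → Fin 2 → ℝ} {d : ℝ} (hx : Spread x d) (i : Fin n) (c : Fin 2) :
    |consField b x i c| ≤ A * d := by
  have hd : 0 ≤ d := by simpa using hx i i c
  calc |consField b x i c| ≤ ∑ j, |b i j * (x j c - x i c)| := Finset.abs_sum_le_sum_abs _ _
    _ ≤ ∑ j, b i j * d := Finset.sum_le_sum fun j _ => by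
        rw [abs_mul, abs_of_nonneg (hb i j)]
        refine mul_le_mul_of_nonneg_left (abs_le.2 ⟨?_, hx j i c⟩) (hb i j)
        linarith [hx i j c]
    _ = (∑ j, b i j) * d := (Finset.sum_mul _ _ _).symm
    _ ≤ A * d := mul_le_mul_of_nonneg_right (hA i) hd

theorem enorm2_consField_le (hb : ∀ i j, 0 ≤ b i j) (hA : ∀ i, ∑ j, b i j ≤ A)
    {x : Fin n → Fin 2 → ℝ} {d : ℝ} (hx : Spread x d) (i : Fin n) :
    enorm2 (consField b x i) ≤ 2 * A * d := by
  have h0 := abs_consField_le hb hA hx i 0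
  have h1 := abs_consField_le hb hA hx i 1
  linarith [enorm2_le_add (consField b x i)]

theorem abs_velocity_le {x : Fin n → Fin 2 → ℝ} {i : Fin n} {G : ℝ}
    (hG : enorm2 (consField b x i) ≤ G) (θ : Fin n → ℝ) (c : Fin 2) :
    |velocity b x θ i c| ≤ G ^ 2 := by
  have h0 := enorm2_nonneg (consField b x i)
  have h1 := (abs_along_le (θ i) (consField b x i)).trans hG
  rw [velocity, abs_mul, abs_mul, abs_of_nonneg h0, sq]
  have hG0 : 0 ≤ G := h0.trans hG
  calc _ ≤ G * G * 1 := by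
        have := abs_heading_le (θ i) c
        gcongr
    _ = G * G := mul_one _

end Bounds

/-- `(X, Θ)` solves the closed-loop system with weights `b` on the compact interval `[0, S]`. -/
def UnicycleOn {n : ℕ} (b : Fin n → Fin n → ℝ) (k : ℝ) (X : ℝ → Fin n → Fin 2 → ℝ)
    (Θ : ℝ → Fin n → ℝ) (S : ℝ) : Prop :=
  ∀ t ∈ Icc 0 S, ∀ i,
    (∀ c, HasDerivWithinAt (fun s => X s i c) (velocity b (X t) (Θ t) i c) (Icc 0 S) t) ∧
    HasDerivWithinAt (fun s => Θ s i) (-k * across (Θ t i) (consField b (X t) i)) (Icc 0 S) t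

namespace UnicycleOn

variable {n : ℕ} {b : Fin n → Fin n → ℝ} {A k S : ℝ} {X : ℝ → Fin n → Fin 2 → ℝ}
  {Θ : ℝ → Fin n → ℝ}

theorem spread_le_two (h : UnicycleOn b k X Θ S) (hb : ∀ i j, 0 ≤ b i j)
    (hA : ∀ i, ∑ j, b i j ≤ A) (hS : S * (8 * ((4 * A) ^ 2 + 2)) ≤ 1) (h0 : Spread (X 0) 1) :
    ∀ t ∈ Icc 0 S, Spread (X t) 2 := by
  have hbound : ∀ t ∈ Icc 0 S, 4 * ((4 * A) ^ 2 + 2) * t ≤ 1 / 2 := fun t ht => by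
    have : 4 * ((4 * A) ^ 2 + 2) * t ≤ 4 * ((4 * A) ^ 2 + 2) * S :=
      mul_le_mul_of_nonneg_left ht.2 (by positivity)
    linarith
  have key := family_neg_of_deriv_neg (ι := Fin n × Fin n × Fin 2) (s := 0) (S := S)
    (φ := fun l t => X t l.1 l.2.2 - X t l.2.1 l.2.2 - 5 / 4 - 4 * ((4 * A) ^ 2 + 2) * t)
    (φ' := fun l t => velocity b (X t) (Θ t) l.1 l.2.2 - velocity b (X t) (Θ t) l.2.1 l.2.2
      - 4 * ((4 * A) ^ 2 + 2))
    (fun l t ht => by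
      have := ((((h t ht l.1).1 l.2.2).sub ((h t ht l.2.1).1 l.2.2)).sub_const (5 / 4)).sub
        ((hasDerivWithinAt_id t (Icc 0 S)).const_mul (4 * ((4 * A) ^ 2 + 2)))
      exact this.congr_deriv (by simp))
    (fun l => by
      have := h0 l.1 l.2.1 l.2.2
      simp only [mul_zero]
      linarith)
    (fun t ht l _ hl => by
      have hsp : Spread (X t) 2 := fun i j c => by
        have := hl (i, j, c)
        have := hbound t ht
        simp only at *
        linarith
      have hv : ∀ i, |velocity b (X t) (Θ t) i l.2.2| ≤ (4 * A) ^ 2 := fun i =>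
        abs_velocity_le ((enorm2_consField_le hb hA hsp i).trans (by linarith)) _ _
      have h1 := (abs_le.1 (hv l.1)).2
      have h2 := (abs_le.1 (hv l.2.1)).1
      have h3 := sq_nonneg (4 * A)
      linarith)
  intro t ht i j c
  have h1 := key t ht (i, j, c)
  have h2 := hbound t ht
  simp only at h1
  linarith

theorem hasDerivWithinAt_along (h : UnicycleOn b k X Θ S) {t : ℝ} (ht : t ∈ Icc 0 S) (i : Fin n) :
    HasDerivWithinAt (fun s => along (Θ s i) (consField b (X s) i))
      (-(k * across (Θ t i) (consField b (X t) i) ^ 2)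
        + along (Θ t i) (consField b (velocity b (X t) (Θ t)) i)) (Icc 0 S) t := by
  have hf : ∀ c, HasDerivWithinAt (fun s => consField b (X s) i c)
      (consField b (velocity b (X t) (Θ t)) i c) (Icc 0 S) t := fun c =>
    HasDerivWithinAt.fun_sum fun j _ =>
      (((h t ht j).1 c).sub ((h t ht i).1 c)).const_mul (b i j)
  have hθ := (h t ht i).2
  refine ((hθ.cos.mul (hf 0)).add (hθ.sin.mul (hf 1))).congr_deriv ?_
  simp only [along, across]
  ring

/-- For `σ = ± 1`, the deficits `M - σ X i c`, corrected by the alignment, satisfy the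
differential inequalities of a deficit system. -/
theorem deficitSystem (h : UnicycleOn b k X Θ S) (hb : ∀ i j, 0 ≤ b i j)
    (hA : ∀ i, ∑ j, b i j ≤ A) (hA0 : 0 < A) (hS : S * (8 * ((4 * A) ^ 2 + 2)) ≤ 1) (hS0 : 0 ≤ S)
    (h0 : Spread (X 0) 1) {σ M β ε : ℝ} (hσ : |σ| = 1) (c : Fin 2) (hM : ∀ i, σ * X 0 i c ≤ M)
    (hβ : 0 ≤ β) (hε : 0 < ε) (h1 : 2 * (4 * A) ^ 2 ≤ β * k * ε)
    (h2 : β * (8 * A * (4 * A) ^ 2) ≤ ε) (h3 : β * (2 * A * (4 * A)) ≤ ε) :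
    DeficitSystem b (4 * A) ε S
      (fun i t => M - σ * X t i c - β * along (Θ t i) (consField b (X t) i) + β * (4 * A))
      (fun i t => -(σ * velocity b (X t) (Θ t) i c)
        - β * (-(k * across (Θ t i) (consField b (X t) i) ^ 2)
          + along (Θ t i) (consField b (velocity b (X t) (Θ t)) i)))
      (fun i t => enorm2 (consField b (X t) i)) (fun i t => σ * consField b (X t) i c) := by
  have hsp := h.spread_le_two hb hA hS h0
  have hg : ∀ i, ∀ t ∈ Icc 0 S, enorm2 (consField b (X t) i) ≤ 4 * A := fun i t ht =>
    (enorm2_consField_le hb hA (hsp t ht) i).trans (by linarith)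
  have hP : ∀ i, ∀ t ∈ Icc 0 S, |along (Θ t i) (consField b (X t) i)| ≤ 4 * A := fun i t ht =>
    (abs_along_le _ _).trans (hg i t ht)
  refine ⟨fun i t ht => ?_, fun i t ht => ?_, fun i t ht => ?_, hg, fun i t ht => ?_, fun i => ?_⟩
  · have := (((((h t ht i).1 c).const_mul σ).const_sub M).sub
      ((h.hasDerivWithinAt_along ht i).const_mul β)).add_const (β * (4 * A))
    exact this
  · set f := consField b (X t) i
    set q := along (Θ t i) (consField b (velocity b (X t) (Θ t)) i)
    set s := across (Θ t i) f
    have hq : |q| ≤ 4 * A * (4 * A) ^ 2 := by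
      have hv : Spread (velocity b (X t) (Θ t)) (2 * (4 * A) ^ 2) := fun j l c' => by
        have e1 := (abs_le.1 (abs_velocity_le (hg j t ht) (Θ t) c')).2
        have e2 := (abs_le.1 (abs_velocity_le (hg l t ht) (Θ t) c')).1
        linarith
      exact (abs_along_le _ _).trans ((enorm2_consField_le hb hA hv i).trans (by linarith))
    have hvel : velocity b (X t) (Θ t) i c
        = enorm2 f * f c - enorm2 f * (s * normalDir (Θ t i) c) := by
      rw [velocity, mul_assoc, along_mul_heading]
      ring
    have herr : -(σ * (enorm2 f * (s * normalDir (Θ t i) c))) ≤ 4 * A * |s| := by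
      refine (neg_le_abs _).trans ?_
      rw [abs_mul, abs_mul, abs_mul, hσ, one_mul, abs_of_nonneg (enorm2_nonneg f)]
      have e1 := hg i t ht
      have e2 := abs_normalDir_le (Θ t i) c
      calc enorm2 f * (|s| * |normalDir (Θ t i) c|) ≤ 4 * A * (|s| * 1) := by gcongr
        _ = 4 * A * |s| := by rw [mul_one]
    have hyoung : 4 * A * |s| ≤ ε / 2 + β * k * s ^ 2 := by
      refine le_of_mul_le_mul_right ?_ hε
      have e1 : 2 * (4 * A) ^ 2 * s ^ 2 ≤ β * k * ε * s ^ 2 :=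
        mul_le_mul_of_nonneg_right h1 (sq_nonneg s)
      have e2 : 2 * (4 * A) ^ 2 * s ^ 2 = 2 * (4 * A * |s|) ^ 2 := by rw [mul_pow _ |s|, sq_abs]; ring
      nlinarith [sq_nonneg (ε - 2 * (4 * A * |s|)), abs_nonneg s, mul_pos hA0 hε]
    have hβq : β * q ≤ ε / 2 := by
      have := mul_le_mul_of_nonneg_left ((le_abs_self q).trans hq) hβ
      linarith
    rw [hvel]
    linarith
  · rw [abs_mul, hσ, one_mul]
    exact abs_apply_le_enorm2 _ c
  · have hPd : ∀ j, along (Θ t i) (consField b (X t) i) - along (Θ t j) (consField b (X t) j)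
        ≤ 2 * (4 * A) := fun j => by
      linarith [(abs_le.1 (hP i t ht)).2, (abs_le.1 (hP j t ht)).1]
    have e1 : ∑ j, b i j * (β * (2 * (4 * A))) ≤ ε := by
      rw [← Finset.sum_mul]
      have := mul_le_mul_of_nonneg_right (hA i) (by positivity : 0 ≤ β * (2 * (4 * A)))
      linarith
    refine le_trans ?_ (add_le_add_right e1 _)
    rw [← Finset.sum_add_distrib, consField, Finset.mul_sum]
    refine Finset.sum_le_sum fun j _ => ?_
    have := mul_le_mul_of_nonneg_left (mul_le_mul_of_nonneg_left (hPd j) hβ) (hb i j)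
    linarith
  · have e1 := (abs_le.1 (hP i 0 ⟨le_rfl, hS0⟩)).2
    have e2 := mul_le_mul_of_nonneg_left e1 hβ
    linarith [hM i]

end UnicycleOn

/-- For large gain, a unit time window (in rescaled time) contracts the spread. -/
theorem exists_spread_contraction {n : ℕ} {b : Fin n → Fin n → ℝ} (hb : ∀ i j, 0 ≤ b i j) {A w : ℝ}
    (hA : ∀ i, ∑ j, b i j ≤ A) (hA0 : 0 < A) (hw0 : 0 < w) (hw1 : w ≤ 1)
    (hw : w * (8 * ((4 * A) ^ 2 + 2)) ≤ 1) {r : Fin n}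
    (hpath : ∀ i, Relation.ReflTransGen (fun p q => 0 < b p q) i r) :
    ∃ q, 0 < q ∧ q < 1 ∧ ∃ k₀ > 0, ∀ k > k₀, ∀ X Θ,
      UnicycleOn b k X Θ w → Spread (X 0) 1 → Spread (X w) q := by
  obtain ⟨η, hη, ε₀, hε₀, hlow⟩ :=
    exists_deficit_lower hb hA hA0.le (by positivity : 0 ≤ 4 * A) hw0 hw1 hw hpath
  set ε := min ε₀ (η / (2 * (4 * A + 4))) with hεdef
  have hε : 0 < ε := by positivity
  have hεη : (4 * A + 4) * ε ≤ η / 2 := by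
    have : ε ≤ η / (2 * (4 * A + 4)) := min_le_right _ _
    rw [le_div_iff₀ (by positivity)] at this
    linarith
  set Q := 8 * A * (4 * A) ^ 2 + 2 * A * (4 * A) + 4 * (4 * A) with hQ
  have hQ0 : 0 < Q := by positivity
  set β := ε / Q with hβdef
  have hβ : 0 < β := by positivity
  have hβQ : β * Q = ε := div_mul_cancel₀ _ hQ0.ne'
  have p1 : 0 ≤ β * (8 * A * (4 * A) ^ 2) := by positivity
  have p2 : 0 ≤ β * (2 * A * (4 * A)) := by positivity
  have p3 : 0 ≤ β * (4 * (4 * A)) := by positivity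
  have hsum : β * (8 * A * (4 * A) ^ 2) + β * (2 * A * (4 * A)) + β * (4 * (4 * A)) = ε := by
    rw [← hβQ, hQ]
    ring
  refine ⟨max (1 / 2) (1 - η / 2), by positivity, max_lt (by norm_num) (by linarith),
    2 * (4 * A) ^ 2 / (β * ε), by positivity, fun k hk X Θ h h0 i j c => ?_⟩
  have hk' : 2 * (4 * A) ^ 2 ≤ β * k * ε := by
    rw [gt_iff_lt, div_lt_iff₀ (by positivity)] at hk
    linarith
  have hsp := h.spread_le_two hb hA hw h0
  have hP : ∀ l, |along (Θ w l) (consField b (X w) l)| ≤ 4 * A := fun l =>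
    (abs_along_le _ _).trans ((enorm2_consField_le hb hA (hsp w ⟨hw0.le, le_rfl⟩) l).trans
      (by linarith))
  have hsys : ∀ {σ M : ℝ}, |σ| = 1 → (∀ l, σ * X 0 l c ≤ M) → _ := fun {σ M} hσ hM =>
    h.deficitSystem hb hA hA0 hw hw0.le h0 (β := β) (ε := ε) hσ c hM hβ.le hε hk'
      (by linarith) (by linarith)
  have hcorr : ∀ l, -(β * along (Θ w l) (consField b (X w) l)) + β * (4 * A)
      ≤ β * (2 * (4 * A)) := fun l => by
    have := mul_le_mul_of_nonneg_left (abs_le.1 (hP l)).1 hβ.le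
    linarith
  have hexpand : ∀ σ M : ℝ, |σ| = 1 → (∀ l, σ * X 0 l c ≤ M) →
      ∀ l, σ * X w l c ≤ M + (4 * A + 3) * ε + β * (2 * (4 * A)) := fun σ M hσ hM l => by
    have := (hsys hσ hM).neg_lt hb (by positivity) hε hw1 w ⟨hw0.le, le_rfl⟩ l
    have := hcorr l
    linarith
  have hcontract : ∀ σ M : ℝ, |σ| = 1 → (∀ l, σ * X 0 l c ≤ M) → σ * X 0 r c ≤ M - 1 / 2 →
      ∀ l, σ * X w l c ≤ M - η + β * (2 * (4 * A)) := fun σ M hσ hM hr l => by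
    have e1 : along (Θ 0 r) (consField b (X 0) r) ≤ 4 * A :=
      (le_abs_self _).trans ((abs_along_le _ _).trans
        ((enorm2_consField_le hb hA (hsp 0 ⟨le_rfl, hw0.le⟩) r).trans (by linarith)))
    have e2 := mul_le_mul_of_nonneg_left e1 hβ.le
    have := hlow ε hε (min_le_left _ _) _ _ _ _ (hsys hσ hM) (by linarith) l
    have := hcorr l
    linarith
  have : Nonempty (Fin n) := ⟨r⟩
  obtain ⟨l₀, hl₀⟩ := Finite.exists_max fun l => X 0 l c
  have hMp : ∀ l, (1 : ℝ) * X 0 l c ≤ X 0 l₀ c := fun l => by linarith [hl₀ l]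
  have hMm : ∀ l, (-1 : ℝ) * X 0 l c ≤ 1 - X 0 l₀ c := fun l => by linarith [h0 l₀ l c]
  refine le_trans ?_ (le_max_right _ _)
  rcases le_total (X 0 r c) (X 0 l₀ c - 1 / 2) with hr | hr
  · have e1 := hcontract 1 _ (by simp) hMp (by linarith) i
    have e2 := hexpand (-1) _ (by simp) hMm j
    linarith
  · have e1 := hexpand 1 _ (by simp) hMp i
    have e2 := hcontract (-1) _ (by simp) hMm (by linarith) j
    linarith

section Solutions

variable {n : ℕ} {Adj : Fin n → Fin n → Bool} {a : Fin n → Fin n → ℝ} {k : ℝ}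
  {x : ℝ → Fin n → Fin 2 → ℝ} {θ : ℝ → Fin n → ℝ} {T : ℝ≥0∞}

/-- Homogeneity: shrinking space by `d` and slowing time by `d` preserves solutions. -/
theorem IsSolOn.rescale (h : IsSolOn Adj a k x θ T) {t₀ d S : ℝ} (ht₀ : 0 ≤ t₀) (hd : 0 < d)
    (hS : ENNReal.ofReal (t₀ + S / d) < T) :
    UnicycleOn (edgeWeight Adj a) k (fun s i c => x (t₀ + s / d) i c / d)
      (fun s => θ (t₀ + s / d)) S := by
  intro t ht i
  have hmaps : MapsTo (fun s => t₀ + s / d) (Icc 0 S) (Ici 0) := fun s hs =>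
    add_nonneg ht₀ (div_nonneg hs.1 hd.le)
  have hτ : HasDerivWithinAt (fun s => t₀ + s / d) (1 / d) (Icc 0 S) t :=
    ((hasDerivWithinAt_id t _).div_const d).const_add t₀
  have hlt : ENNReal.ofReal (t₀ + t / d) < T :=
    lt_of_le_of_lt (ENNReal.ofReal_le_ofReal (by gcongr; exact ht.2)) hS
  obtain ⟨hx, hθ⟩ := h (t₀ + t / d) (hmaps ht) hlt i
  rw [velocity_eq] at hx
  rw [omegaFB_eq] at hθ
  refine ⟨fun c => ?_, ?_⟩
  · refine ((((hasDerivWithinAt_pi.1 hx c).comp t hτ hmaps).div_const d)).congr_deriv ?_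
    rw [velocity_div _ _ _ _ _ hd]
    ring
  · refine (hθ.comp t hτ hmaps).congr_deriv ?_
    rw [consField_div, across_div]
    ring

theorem IsSolOn.spread_window (h : IsSolOn Adj a k x θ T) {w q : ℝ}
    (hcontr : ∀ X Θ, UnicycleOn (edgeWeight Adj a) k X Θ w → Spread (X 0) 1 → Spread (X w) q)
    {t₀ d : ℝ} (ht₀ : 0 ≤ t₀) (hd : 0 < d) (hx : Spread (x t₀) d)
    (hT : ENNReal.ofReal (t₀ + w / d) < T) : Spread (x (t₀ + w / d)) (q * d) := by
  have h1 := hcontr _ _ (h.rescale ht₀ hd hT) (by simpa [div_self hd.ne'] using hx.div hd)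
  intro i j c
  have h2 := h1 i j c
  rwa [← sub_div, div_le_iff₀ hd] at h2

theorem IsSolOn.spread_le_two_mul (h : IsSolOn Adj a k x θ T)
    (hb : ∀ i j, 0 ≤ edgeWeight Adj a i j) {A w q : ℝ}
    (hA : ∀ i, ∑ j, edgeWeight Adj a i j ≤ A) (hw0 : 0 < w)
    (hw : w * (8 * ((4 * A) ^ 2 + 2)) ≤ 1) (hq1 : q ≤ 1)
    (hcontr : ∀ X Θ, UnicycleOn (edgeWeight Adj a) k X Θ w → Spread (X 0) 1 → Spread (X w) q)
    {t₀ d : ℝ} (ht₀ : 0 ≤ t₀) (hd : 0 < d) (hx : Spread (x t₀) d) :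
    ∀ t ≥ t₀, ENNReal.ofReal t < T → Spread (x t) (2 * d) := by
  have hwd : 0 < w / d := div_pos hw0 hd
  have key : ∀ N : ℕ, ∀ t₀, 0 ≤ t₀ → Spread (x t₀) d → ∀ t ≥ t₀, t ≤ t₀ + (N + 1) * (w / d) →
      ENNReal.ofReal t < T → Spread (x t) (2 * d) := by
    intro N
    induction N with
    | zero =>
      intro t₀ ht₀ hx t ht htw hT
      have ht' : t₀ + (t - t₀) * d / d = t := by
        field_simp
        ring
      have hS : (t - t₀) * d ≤ w := by
        rw [← le_div_iff₀ hd]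
        simp only [Nat.cast_zero, zero_add, one_mul] at htw
        linarith
      have h1 := (h.rescale (S := (t - t₀) * d) ht₀ hd (by rwa [ht'])).spread_le_two hb hA
        ((mul_le_mul_of_nonneg_right hS (by positivity)).trans hw)
        (by simpa [div_self hd.ne'] using hx.div hd) ((t - t₀) * d)
        ⟨mul_nonneg (sub_nonneg.2 ht) hd.le, le_rfl⟩
      intro i j c
      have h2 := h1 i j c
      rwa [ht', ← sub_div, div_le_iff₀ hd] at h2
    | succ N ih =>
      intro t₀ ht₀ hx t ht htw hT
      push_cast at htw
      rcases le_total t (t₀ + w / d) with hle | hle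
      · exact ih t₀ ht₀ hx t ht (by nlinarith [(Nat.cast_nonneg N : (0 : ℝ) ≤ N)]) hT
      · have hx' := (h.spread_window hcontr ht₀ hd hx
          ((ENNReal.ofReal_le_ofReal hle).trans_lt hT)).mono (mul_le_of_le_one_left hd.le hq1)
        exact ih _ (by positivity) hx' t hle (by linarith) hT
  intro t ht hT
  obtain ⟨N, hN⟩ := exists_nat_ge ((t - t₀) / (w / d))
  rw [div_le_iff₀ hwd] at hN
  exact key N t₀ ht₀ hx t ht (by nlinarith) hT

theorem IsSolOn.exists_spread_le_pow (h : IsSolOn Adj a k x θ ⊤) {w q : ℝ} (hw0 : 0 < w)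
    (hq0 : 0 < q)
    (hcontr : ∀ X Θ, UnicycleOn (edgeWeight Adj a) k X Θ w → Spread (X 0) 1 → Spread (X w) q)
    {d : ℝ} (hd : 0 < d) (hx : Spread (x 0) d) (m : ℕ) :
    ∃ t ≥ 0, Spread (x t) (q ^ m * d) := by
  induction m with
  | zero => exact ⟨0, le_rfl, by simpa using hx⟩
  | succ m ih =>
    obtain ⟨t, ht, hxt⟩ := ih
    have hp : 0 < q ^ m * d := by positivity
    refine ⟨t + w / (q ^ m * d), by positivity, ?_⟩
    have := h.spread_window hcontr ht hp hxt ENNReal.ofReal_lt_top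
    rwa [← mul_assoc, ← pow_succ'] at this

theorem Spread.Dmax_le {y : Fin n → Fin 2 → ℝ} {d : ℝ} (h : Spread y d) (hd : 0 ≤ d) :
    Dmax y ≤ 2 * d := by
  refine Real.iSup_le (fun i => Real.iSup_le (fun j => ?_) (by positivity)) (by positivity)
  have hc : ∀ c, |(y i - y j) c| ≤ d := fun c =>
    abs_le.2 ⟨by have := h j i c; simp only [Pi.sub_apply]; linarith, h i j c⟩
  linarith [enorm2_le_add (y i - y j), hc 0, hc 1]

theorem Dmax_nonneg (y : Fin n → Fin 2 → ℝ) : 0 ≤ Dmax y :=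
  Real.iSup_nonneg fun _ => Real.iSup_nonneg fun _ => enorm2_nonneg _

theorem spread_Dmax (y : Fin n → Fin 2 → ℝ) : Spread y (Dmax y) := fun i j c =>
  calc y i c - y j c ≤ enorm2 (y i - y j) :=
        (le_abs_self _).trans (abs_apply_le_enorm2 (y i - y j) c)
    _ ≤ ⨆ j, enorm2 (y i - y j) :=
        le_ciSup (f := fun j => enorm2 (y i - y j)) (Set.finite_range _).bddAbove j
    _ ≤ Dmax y :=
        le_ciSup (f := fun i => ⨆ j, enorm2 (y i - y j)) (Set.finite_range _).bddAbove i

/-- The closed-loop vector field on the joint state space. -/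
noncomputable def closedLoop (b : Fin n → Fin n → ℝ) (k : ℝ)
    (z : (Fin n → Fin 2 → ℝ) × (Fin n → ℝ)) : (Fin n → Fin 2 → ℝ) × (Fin n → ℝ) :=
  (fun i => velocity b z.1 z.2 i, fun i => -k * across (z.2 i) (consField b z.1 i))

theorem abs_enorm2_sub_le (u v : Fin 2 → ℝ) : |enorm2 u - enorm2 v| ≤ enorm2 (u - v) := by
  have h : ∀ v : Fin 2 → ℝ, enorm2 v = ‖WithLp.toLp 2 v‖ := fun v => by
    simp [enorm2, EuclideanSpace.norm_eq, Fin.sum_univ_two]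
  rw [h, h, h, WithLp.toLp_sub]
  exact abs_norm_sub_norm_le _ _

theorem lipschitzWith_enorm2_pi :
    LipschitzWith 2 fun (v : Fin n → Fin 2 → ℝ) (i : Fin n) => enorm2 (v i) := by
  refine LipschitzWith.of_dist_le_mul fun u v => ?_
  refine (dist_pi_le_iff (by positivity)).2 fun i => ?_
  have hc : ∀ c, |(u i - v i) c| ≤ dist u v := fun c =>
    ((dist_le_pi_dist (u i) (v i) c).trans (dist_le_pi_dist u v i))
  have := abs_enorm2_sub_le (u i) (v i)
  have := enorm2_le_add (u i - v i)
  rw [Real.dist_eq, NNReal.coe_ofNat]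
  linarith [hc 0, hc 1]

theorem contDiff_heading (c : Fin 2) : ContDiff ℝ 1 fun θ => heading θ c := by
  fin_cases c
  · exact Real.contDiff_cos
  · exact Real.contDiff_sin

theorem ContDiff.locallyLipschitz_comp_prodMk {E F G : Type*} [NormedAddCommGroup E]
    [NormedSpace ℝ E] [NormedAddCommGroup F] [NormedSpace ℝ F] [NormedAddCommGroup G]
    [NormedSpace ℝ G] {Φ : E × F → G} (hΦ : ContDiff ℝ 1 Φ) {g : E → F}
    (hg : LocallyLipschitz g) : LocallyLipschitz fun z => Φ (z, g z) :=
  hΦ.locallyLipschitz.comp (LocallyLipschitz.id.prodMk hg)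

theorem locallyLipschitz_closedLoop (b : Fin n → Fin n → ℝ) (k : ℝ) :
    LocallyLipschitz (closedLoop b k) := by
  let Φ : ((Fin n → Fin 2 → ℝ) × (Fin n → ℝ)) × (Fin n → ℝ) →
      (Fin n → Fin 2 → ℝ) × (Fin n → ℝ) := fun p =>
    (fun i c => p.2 i * along (p.1.2 i) (consField b p.1.1 i) * heading (p.1.2 i) c,
      fun i => -k * across (p.1.2 i) (consField b p.1.1 i))
  have hΦ : ContDiff ℝ 1 Φ := by
    refine ContDiff.prodMk (contDiff_pi.2 fun i => contDiff_pi.2 fun c => ?_)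
      (contDiff_pi.2 fun i => ?_)
    · have := contDiff_heading c
      simp only [along, consField]
      fun_prop
    · simp only [across, consField]
      fun_prop
  have hf : ContDiff ℝ 1 fun z : (Fin n → Fin 2 → ℝ) × (Fin n → ℝ) => consField b z.1 := by
    refine contDiff_pi.2 fun i => contDiff_pi.2 fun c => ?_
    simp only [consField]
    fun_prop
  have hg : LocallyLipschitz fun z : (Fin n → Fin 2 → ℝ) × (Fin n → ℝ) =>
      fun i => enorm2 (consField b z.1 i) :=
    lipschitzWith_enorm2_pi.locallyLipschitz.comp hf.locallyLipschitz
  have e : closedLoop b k = fun z => Φ (z, fun i => enorm2 (consField b z.1 i)) := rfl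
  rw [e]
  exact hΦ.locallyLipschitz_comp_prodMk hg

theorem norm_closedLoop_le {b : Fin n → Fin n → ℝ} {z : (Fin n → Fin 2 → ℝ) × (Fin n → ℝ)} {G : ℝ}
    (hG0 : 0 ≤ G) (hG : ∀ i, enorm2 (consField b z.1 i) ≤ G) (k : ℝ) :
    ‖closedLoop b k z‖ ≤ G ^ 2 + |k| * G := by
  refine norm_prod_le_iff.2 ⟨?_, ?_⟩
  · refine (pi_norm_le_iff_of_nonneg (by positivity)).2 fun i =>
      (pi_norm_le_iff_of_nonneg (by positivity)).2 fun c => ?_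
    have := abs_velocity_le (hG i) z.2 c
    have : 0 ≤ |k| * G := by positivity
    simp only [closedLoop, Real.norm_eq_abs]
    linarith
  · refine (pi_norm_le_iff_of_nonneg (by positivity)).2 fun i => ?_
    have := mul_le_mul_of_nonneg_left ((abs_across_le (z.2 i) (consField b z.1 i)).trans (hG i))
      (abs_nonneg k)
    simp only [closedLoop, Real.norm_eq_abs, abs_mul, abs_neg]
    nlinarith [sq_nonneg G]

theorem isSolOn_iff : IsSolOn Adj a k x θ T ↔ ∀ t : ℝ, 0 ≤ t → ENNReal.ofReal t < T →
    HasDerivWithinAt (fun s => (x s, θ s)) (closedLoop (edgeWeight Adj a) k (x t, θ t))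
      (Ici 0) t := by
  refine forall₃_congr fun t _ _ => ?_
  simp only [velocity_eq, omegaFB_eq]
  refine ⟨fun h => (hasDerivWithinAt_pi.2 fun i => (h i).1).prodMk
    (hasDerivWithinAt_pi.2 fun i => (h i).2), fun h i => ⟨?_, ?_⟩⟩
  · exact hasDerivWithinAt_pi.1 h.fst i
  · exact hasDerivWithinAt_pi.1 h.snd i

theorem isSolOn_zero : IsSolOn Adj a k (fun _ _ _ => 0) (fun _ _ => 0) T := by
  intro t _ _ i
  have hf : consField (edgeWeight Adj a) (fun _ _ => 0) i = 0 := by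
    ext c
    simp [consField]
  rw [omegaFB_eq, uFB, fcons_eq_consField, hf]
  constructor
  · simpa [enorm2] using hasDerivWithinAt_const t (Ici (0 : ℝ)) (fun _ : Fin 2 => (0 : ℝ))
  · simpa [across] using hasDerivWithinAt_const t (Ici (0 : ℝ)) (0 : ℝ)

/-- A solution of bounded spread on a bounded interval has a proper extension. -/
theorem IsSolOn.exists_extension {τ : ℝ} (hτ : 0 < τ) (h : IsSolOn Adj a k x θ (ENNReal.ofReal τ))
    (hb : ∀ i j, 0 ≤ edgeWeight Adj a i j)
    {A d : ℝ} (hA0 : 0 ≤ A) (hd : 0 ≤ d) (hA : ∀ i, ∑ j, edgeWeight Adj a i j ≤ A)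
    (hx : ∀ t : ℝ, 0 ≤ t → ENNReal.ofReal t < ENNReal.ofReal τ → Spread (x t) d) :
    ∃ τ' > τ, ∃ Z : ℝ → (Fin n → Fin 2 → ℝ) × (Fin n → ℝ),
      (∀ t ∈ Ico 0 τ', HasDerivWithinAt Z (closedLoop (edgeWeight Adj a) k (Z t)) (Ici 0) t) ∧
      ∀ t ∈ Ico 0 τ, Z t = (x t, θ t) := by
  have hlt : ∀ t : ℝ, t < τ → ENNReal.ofReal t < ENNReal.ofReal τ := fun t ht =>
    (ENNReal.ofReal_lt_ofReal_iff hτ).2 ht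
  have hY := fun t (ht : t ∈ Ico 0 τ) => isSolOn_iff.1 h t ht.1 (hlt t ht.2)
  have hV := locallyLipschitz_closedLoop (edgeWeight Adj a) k
  have hC := fun t (ht : t ∈ Ico 0 τ) => norm_closedLoop_le (z := (x t, θ t)) (by positivity)
      (fun i => enorm2_consField_le hb hA (hx t ht.1 (hlt t ht.2)) i) k
  exact hV.exists_extension hτ hY hC

/-- A maximal solution of bounded spread is complete. -/
theorem IsMaxSol.eq_top (h : IsMaxSol Adj a k x θ T) (hb : ∀ i j, 0 ≤ edgeWeight Adj a i j)
    {A d : ℝ} (hA0 : 0 ≤ A) (hd : 0 ≤ d) (hA : ∀ i, ∑ j, edgeWeight Adj a i j ≤ A)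
    (hx : ∀ t : ℝ, 0 ≤ t → ENNReal.ofReal t < T → Spread (x t) d) : T = ⊤ := by
  by_contra hT
  obtain ⟨hsol, hmax⟩ := h
  rcases eq_or_ne T 0 with rfl | hT0
  · exact hmax _ _ ⊤ ENNReal.zero_lt_top isSolOn_zero (fun t _ ht => absurd ht not_lt_zero)
  have hτ := ENNReal.toReal_pos hT0 hT
  rw [← ENNReal.ofReal_toReal hT] at hsol hx hmax
  obtain ⟨τ', hτ', Z, hZ, hZx⟩ := hsol.exists_extension hτ hb hA0 hd hA hx
  have hτ'0 := hτ.trans hτ'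
  refine hmax (fun t => (Z t).1) (fun t => (Z t).2) (ENNReal.ofReal τ')
    ((ENNReal.ofReal_lt_ofReal_iff hτ'0).2 hτ')
    (isSolOn_iff.2 fun t ht htT => hZ t ⟨ht, (ENNReal.ofReal_lt_ofReal_iff hτ'0).1 htT⟩)
    fun t ht htT => ?_
  rw [hZx t ⟨ht, (ENNReal.ofReal_lt_ofReal_iff hτ).1 htT⟩]
  exact ⟨rfl, rfl⟩

end Solutions
end Rendezvous

/-- if the digraph (no self-loops, positive weights) contains a reverse
directed spanning tree then there is `k1* > 0` such that for every `k1 > k1*` the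
proposed feedback solves the rendezvous control problem: the rendezvous manifold is
stable, and every maximal solution is complete and satisfies `D(x(t)) → 0`. -/
theorem rendezvous_control {n : ℕ} (Adj : Fin n → Fin n → Bool)
    (hloop : ∀ i, Adj i i = false)
    (a : Fin n → Fin n → ℝ) (ha : ∀ i j, Adj i j = true → 0 < a i j)
    (htree : ∃ r : Fin n, ∀ i, Relation.ReflTransGen (fun p q => Adj p q = true) i r) :
    ∃ k1s : ℝ, 0 < k1s ∧ ∀ k1 : ℝ, k1s < k1 →
      (∀ ε : ℝ, 0 < ε → ∃ δ : ℝ, 0 < δ ∧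
        ∀ (x : ℝ → Fin n → Fin 2 → ℝ) (θ : ℝ → Fin n → ℝ) (T : ℝ≥0∞),
          IsSolOn Adj a k1 x θ T → Dmax (x 0) < δ →
            ∀ t : ℝ, 0 ≤ t → ENNReal.ofReal t < T → Dmax (x t) < ε) ∧
      (∀ (x : ℝ → Fin n → Fin 2 → ℝ) (θ : ℝ → Fin n → ℝ) (T : ℝ≥0∞),
          IsMaxSol Adj a k1 x θ T →
            T = ⊤ ∧ Filter.Tendsto (fun t => Dmax (x t)) Filter.atTop (nhds 0)) := by
  obtain ⟨r, hr⟩ := htree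
  set b := edgeWeight Adj a with hbdef
  have hb : ∀ i j, 0 ≤ b i j := fun i j => by
    rw [hbdef, edgeWeight]
    split_ifs with h
    exacts [(ha i j h).le, le_rfl]
  have hpath : ∀ i, Relation.ReflTransGen (fun p q => 0 < b p q) i r := fun i =>
    Relation.ReflTransGen.mono
      (fun p q hpq => by simpa [hbdef, edgeWeight, hpq] using ha p q hpq) _ _ (hr i)
  set A := 1 + ∑ i, ∑ j, b i j with hAdef
  have hrow : ∀ i, 0 ≤ ∑ j, b i j := fun i => Finset.sum_nonneg fun j _ => hb i j
  have hA0 : 0 < A := add_pos_of_pos_of_nonneg one_pos (Finset.sum_nonneg fun i _ => hrow i)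
  have hA : ∀ i, ∑ j, b i j ≤ A := fun i => by
    have := Finset.single_le_sum (fun l _ => hrow l) (Finset.mem_univ i)
    linarith
  set w := 1 / (8 * ((4 * A) ^ 2 + 2)) with hwdef
  have hw0 : 0 < w := by positivity
  have hw : w * (8 * ((4 * A) ^ 2 + 2)) ≤ 1 := (div_mul_cancel₀ _ (by positivity)).le
  have hw1 : w ≤ 1 := (div_le_one (by positivity)).2 (by nlinarith [sq_nonneg (4 * A)])
  obtain ⟨q, hq0, hq1, k₀, hk₀, hcontr⟩ :=
    exists_spread_contraction hb hA hA0 hw0 hw1 hw hpath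
  refine ⟨k₀, hk₀, fun k hk => ⟨fun ε hε => ⟨ε / 5, by positivity, ?_⟩, ?_⟩⟩
  · intro x θ T hsol hx t ht htT
    have h1 := hsol.spread_le_two_mul hb hA hw0 hw hq1.le (hcontr k hk) le_rfl
      (by positivity) ((spread_Dmax (x 0)).mono hx.le) t ht htT
    linarith [h1.Dmax_le (by positivity)]
  · intro x θ T hmax
    set d := Dmax (x 0) + 1
    have hd : 0 < d := add_pos_of_nonneg_of_pos (Dmax_nonneg _) one_pos
    have hx0 : Spread (x 0) d := (spread_Dmax (x 0)).mono (by simp [d])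
    have hbound := fun (t₀ e : ℝ) ht₀ he hx =>
      hmax.1.spread_le_two_mul (t₀ := t₀) (d := e) hb hA hw0 hw hq1.le (hcontr k hk) ht₀ he hx
    obtain rfl : T = ⊤ := hmax.eq_top hb hA0.le (by positivity) hA (hbound 0 d le_rfl hd hx0)
    refine ⟨rfl, Metric.tendsto_atTop.2 fun ε hε => ?_⟩
    obtain ⟨m, hm⟩ := exists_pow_lt_of_lt_one (show 0 < ε / (4 * d) by positivity) hq1
    rw [lt_div_iff₀ (by positivity)] at hm
    obtain ⟨t₀, ht₀, hxt₀⟩ := hmax.1.exists_spread_le_pow hw0 hq0 (hcontr k hk) hd hx0 m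
    refine ⟨t₀, fun t ht => ?_⟩
    have hp : 0 < q ^ m * d := by positivity
    have := (hbound t₀ _ ht₀ hp hxt₀ t ht ENNReal.ofReal_lt_top).Dmax_le (by positivity)
    rw [Real.dist_eq, sub_zero, abs_of_nonneg (Dmax_nonneg _)]
    linarith
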